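/- Let u : C ⥤ D be a fully faithful functor between categories such that every object Y of D is a retract of u(X) for some object X of C, i.e. there exist morphisms r : Y ⟶ u(X) and s : u(X) ⟶ Y whose composite r ≫ s equals the identity of Y. Then the induction functor u_* : C^ ⥤ D^ (right Kan extension along uᵒᵖ) is an equivalence of categories. -/

import Mathlib

open CategoryTheory

universe u

theorem isIso_of_retract
    {C D : Type u} [SmallCategory C] [SmallCategory D] (u : C ⥤ D)
    (hretract : ∀ Y : D, ∃ (X : C) (r : Y ⟶ u.obj X) (s : u.obj X ⟶ Y), r ≫ s = 𝟙 Y)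
    {G H : Dᵒᵖ ⥤ Type u} (α : G ⟶ H)
    (h2 : ∀ X : C, IsIso (α.app (Opposite.op (u.obj X)))) : IsIso α := by
  rw [NatTrans.isIso_iff_isIso_app]
  rintro ⟨Y⟩
  obtain ⟨X, r, s, hrs⟩ := hretract Y
  have hX := h2 X
  have hrs' : s.op ≫ r.op = 𝟙 (Opposite.op Y) := by rw [← op_comp, hrs, op_id]
  refine ⟨H.map s.op ≫ inv (α.app (Opposite.op (u.obj X))) ≫ G.map r.op, ?_, ?_⟩
  · rw [← NatTrans.naturality_assoc, IsIso.hom_inv_id_assoc, ← G.map_comp, hrs', G.map_id]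
  · rw [Category.assoc, Category.assoc, NatTrans.naturality, IsIso.inv_hom_id_assoc,
      ← H.map_comp, hrs', H.map_id]

/-- If `u : C ⥤ D` is fully faithful and every object of `D` is a retract of an object
in the image of `u`, then the induction functor `u_* : C^ ⥤ D^` (right Kan extension
along `uᵒᵖ`) is an equivalence. -/
theorem induction_isEquivalence_of_retract
    {C D : Type u} [SmallCategory C] [SmallCategory D]
    (u : C ⥤ D) [u.Full] [u.Faithful]
    (hretract : ∀ Y : D, ∃ (X : C) (r : Y ⟶ u.obj X) (s : u.obj X ⟶ Y), r ≫ s = 𝟙 Y) :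
    (u.op.ran : (Cᵒᵖ ⥤ Type u) ⥤ (Dᵒᵖ ⥤ Type u)).IsEquivalence := by
  let adj := u.op.ranAdjunction (Type u)
  have hc : IsIso adj.counit := by
    dsimp only [adj]
    infer_instance
  have hu : ∀ G : Dᵒᵖ ⥤ Type u, IsIso (adj.unit.app G) := by
    intro G
    have h1 : IsIso (((Functor.whiskeringLeft _ _ (Type u)).obj u.op).map (adj.unit.app G)) := by
      have := adj.left_triangle_components G
      have hid : IsIso (((Functor.whiskeringLeft _ _ (Type u)).obj u.op).map (adj.unit.app G) ≫
          adj.counit.app (((Functor.whiskeringLeft _ _ (Type u)).obj u.op).obj G)) := by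
        rw [this]
        exact IsIso.id _
      exact IsIso.of_isIso_comp_right _
        (adj.counit.app (((Functor.whiskeringLeft _ _ (Type u)).obj u.op).obj G))
    have h2 : ∀ X : C, IsIso ((adj.unit.app G).app (Opposite.op (u.obj X))) := fun X =>
      inferInstanceAs (IsIso ((((Functor.whiskeringLeft _ _ (Type u)).obj u.op).map
        (adj.unit.app G)).app (Opposite.op X)))
    exact isIso_of_retract u hretract _ h2
  have hu' : IsIso adj.unit := by
    rw [NatTrans.isIso_iff_isIso_app]
    exact hu
  exact adj.toEquivalence.isEquivalence_inverse
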